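/- arXiv:math/0608546 — 2 statements merged into one kernel-verified Lean document; each statement's English description precedes it below -/
import Mathlib

section
/- Let 0 < k < n be integers and let λ and μ be partitions fitting in the k×(n−k) rectangle such that λ_i + μ_{k+1−i} ≤ n−k for all 1 ≤ i ≤ k. Let m = #{ j : 1 ≤ j ≤ n−k and λ'_j + μ'_{n−k+1−j} < k }. Define λ̃ to be the partition whose conjugate is given by λ̃'_j = λ'_j + 1 if λ'_j + μ'_{n−k+1−j} < k, and λ̃'_j = λ'_j otherwise. Then: (a) λ̃ fits in the k×(n−k) rectangle, λ̃/λ is a horizontal strip of size m (i.e. λ_i ≤ λ̃_i and λ̃_{i+1} ≤ λ_i for all i), and λ̃_i + μ_{k+1−i} ≤ n−k for all i; (b) λ̃ is the unique partition with these properties of strip size m, and no partition ν fitting in the rectangle with ν/λ a horizontal strip of size greater than m satisfies ν_i + μ_{k+1−i} ≤ n−k for all i. -/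
/-- The conjugate (transpose) of a partition, 0-indexed:
`conj p j = #{i | p i > j}`, i.e. `conj p (j-1) = p'_j` in 1-indexed notation. -/
noncomputable def conj (p : ℕ → ℕ) (j : ℕ) : ℕ := Set.ncard {i : ℕ | j < p i}

/-- `p` is a partition (0-indexed parts, so `p i` is the `(i+1)`-st part)
fitting in the `k × r` rectangle: at most `k` nonzero parts, each of size at most `r`. -/
def IsRectPartition (k r : ℕ) (p : ℕ → ℕ) : Prop :=
  (∀ i, p (i + 1) ≤ p i) ∧ (∀ i, k ≤ i → p i = 0) ∧ (∀ i, p i ≤ r)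

/-- The box in row `i`, column `j` (both 0-indexed) lies in the skew shape `nu/lam`. -/
def InSkew (lam nu : ℕ → ℕ) (i j : ℕ) : Prop := lam i ≤ j ∧ j < nu i

/-- A Littlewood–Richardson filling of the skew shape `nu/lam` of content `mu`:
a filling with positive integers (recorded as a function `T` that is `0` outside
the shape), weakly increasing along rows (left to right), strictly increasing
down columns, whose reading word (entries read right to left along each row, rows
taken top to bottom) is Yamanouchi -- every prefix of the word contains, for each
`e ≥ 1`, at least as many occurrences of `e` as of `e+1`; a prefix of the reading
word consists of the boxes `(i,j)` with `i < m`, or `i = m` and `j ≥ c` --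
and whose entries have content `mu`: the value `e+1` occurs exactly `mu e` times
(0-indexed, i.e. the value `i` occurs `μ_i` times). -/
def IsLRFilling (lam mu nu : ℕ → ℕ) (T : ℕ → ℕ → ℕ) : Prop :=
  (∀ i j, ¬ InSkew lam nu i j → T i j = 0) ∧
  (∀ i j, InSkew lam nu i j → 1 ≤ T i j) ∧
  (∀ i j1 j2, InSkew lam nu i j1 → InSkew lam nu i j2 → j1 ≤ j2 → T i j1 ≤ T i j2) ∧
  (∀ i1 i2 j, i1 < i2 → InSkew lam nu i1 j → InSkew lam nu i2 j → T i1 j < T i2 j) ∧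
  (∀ m c e, 1 ≤ e →
    Set.ncard {p : ℕ × ℕ | InSkew lam nu p.1 p.2 ∧
        (p.1 < m ∨ (p.1 = m ∧ c ≤ p.2)) ∧ T p.1 p.2 = e + 1} ≤
      Set.ncard {p : ℕ × ℕ | InSkew lam nu p.1 p.2 ∧
        (p.1 < m ∨ (p.1 = m ∧ c ≤ p.2)) ∧ T p.1 p.2 = e}) ∧
  (∀ e, Set.ncard {p : ℕ × ℕ | InSkew lam nu p.1 p.2 ∧ T p.1 p.2 = e + 1} = mu e)

/-- The Littlewood–Richardson number `c_{λμ}^{ν}`: the number of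
Littlewood–Richardson fillings of `ν/λ` of content `μ`. -/
noncomputable def lrCoeff (lam mu nu : ℕ → ℕ) : ℕ :=
  Set.ncard {T : ℕ → ℕ → ℕ | IsLRFilling lam mu nu T}

/-- `ν/λ` is a horizontal strip: `λ ⊆ ν` with at most one box in each column. -/
def IsHorizontalStrip (lam nu : ℕ → ℕ) : Prop :=
  ∀ i, lam i ≤ nu i ∧ nu (i + 1) ≤ lam i


theorem lt_conj_iff {k r : ℕ} {p : ℕ → ℕ} (hp : IsRectPartition k r p) (i j : ℕ) :
    i < conj p j ↔ j < p i := by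
  obtain ⟨h1, h2, h3⟩ := hp
  have hanti : Antitone p := antitone_nat_of_succ_le h1
  have hex : ∃ N, p N ≤ j := ⟨k, by rw [h2 k le_rfl]; exact Nat.zero_le _⟩
  classical
  have hset : {i : ℕ | j < p i} = ↑(Finset.range (Nat.find hex)) := by
    ext a
    simp only [Set.mem_ofPred_eq, Finset.coe_range, Set.mem_Iio]
    constructor
    · intro ha
      by_contra hcon
      have := hanti (not_lt.mp hcon)
      have h4 := Nat.find_spec hex
      omega
    · intro ha
      have := Nat.find_min hex ha
      omega
  have hc : conj p j = Nat.find hex := by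
    unfold conj
    rw [hset, Set.ncard_coe_finset, Finset.card_range]
  have hm : i ∈ {i : ℕ | j < p i} ↔ i < Nat.find hex := by
    rw [hset]; simp
  rw [hc, ← hm]
  rfl

theorem sum_conj {k r : ℕ} {p : ℕ → ℕ} (hp : IsRectPartition k r p) :
    ∑ i ∈ Finset.range k, p i = ∑ j ∈ Finset.range r, conj p j := by
  have h1 : ∀ i, p i = ∑ j ∈ Finset.range r, if j < p i then 1 else 0 := by
    intro i
    rw [← Finset.card_filter]
    have : (Finset.range r).filter (fun j => j < p i) = Finset.range (p i) := by
      ext a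
      have := hp.2.2 i
      simp only [Finset.mem_filter, Finset.mem_range]
      omega
    rw [this, Finset.card_range]
  have h2 : ∀ j, conj p j = ∑ i ∈ Finset.range k, if j < p i then 1 else 0 := by
    intro j
    rw [← Finset.card_filter]
    have : (Finset.range k).filter (fun i => j < p i) = Finset.range (conj p j) := by
      ext a
      have h3 := hp.2.1 a
      simp only [Finset.mem_filter, Finset.mem_range, lt_conj_iff hp]
      omega
    rw [this, Finset.card_range]
  rw [Finset.sum_congr rfl (fun i _ => h1 i), Finset.sum_comm]
  exact Finset.sum_congr rfl (fun j _ => (h2 j).symm)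

/-- Let `λ`, `μ` fit in the `k × (n−k)` rectangle with
`λ_i + μ_{k+1−i} ≤ n−k` for all `1 ≤ i ≤ k`, and let
`m = #{j : 1 ≤ j ≤ n−k, λ'_j + μ'_{n−k+1−j} < k}` (expressed 0-indexed below).
Then the partition `λ̃` whose conjugate is `λ̃'_j = λ'_j + 1` if
`λ'_j + μ'_{n−k+1−j} < k` and `λ̃'_j = λ'_j` otherwise exists; it fits in the
rectangle, `λ̃/λ` is a horizontal strip of size `m`, and
`λ̃_i + μ_{k+1−i} ≤ n−k` for all `i`.  Moreover `λ̃` is the unique such partition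
of strip size `m`, and no partition `ν` in the rectangle with `ν/λ` a horizontal
strip of size greater than `m` satisfies `ν_i + μ_{k+1−i} ≤ n−k` for all `i`. -/
theorem exists_unique_max_horizontal_strip (n k : ℕ) (hk : 0 < k) (hkn : k < n)
    (lam mu : ℕ → ℕ)
    (hlam : IsRectPartition k (n - k) lam) (hmu : IsRectPartition k (n - k) mu)
    (hno : ∀ i, i < k → lam i + mu (k - 1 - i) ≤ n - k)
    (m : ℕ)
    (hm : m = Set.ncard {j : ℕ | j < n - k ∧ conj lam j + conj mu (n - k - 1 - j) < k}) :
    ∃ tlam : ℕ → ℕ,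
      (∀ j, j < n - k → conj tlam j =
        if conj lam j + conj mu (n - k - 1 - j) < k then conj lam j + 1 else conj lam j) ∧
      IsRectPartition k (n - k) tlam ∧
      IsHorizontalStrip lam tlam ∧
      (∑ i ∈ Finset.range k, tlam i) = (∑ i ∈ Finset.range k, lam i) + m ∧
      (∀ i, i < k → tlam i + mu (k - 1 - i) ≤ n - k) ∧
      (∀ nu : ℕ → ℕ, IsRectPartition k (n - k) nu → IsHorizontalStrip lam nu →
        (∀ i, i < k → nu i + mu (k - 1 - i) ≤ n - k) →
          (∑ i ∈ Finset.range k, nu i) ≤ (∑ i ∈ Finset.range k, lam i) + m ∧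
          ((∑ i ∈ Finset.range k, nu i) = (∑ i ∈ Finset.range k, lam i) + m →
            nu = tlam)) := by
  classical
  generalize n - k = r at *
  have lanti : Antitone lam := antitone_nat_of_succ_le hlam.1
  have manti : Antitone mu := antitone_nat_of_succ_le hmu.1
  obtain ⟨tlam, ht⟩ : ∃ t : ℕ → ℕ, ∀ i, t i = if i < k then
      (if i = 0 then r - mu (k - 1 - i) else min (r - mu (k - 1 - i)) (lam (i - 1))) else 0 :=
    ⟨_, fun _ => rfl⟩
  have hle : ∀ i, tlam i ≤ r := by
    intro i; rw [ht]; split_ifs <;> omega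
  have hstrip : IsHorizontalStrip lam tlam := by
    intro i
    constructor
    · rw [ht]
      by_cases hi : i < k
      · have h1 := hno i hi
        have h2 : lam i ≤ lam (i - 1) := lanti (by omega)
        split_ifs <;> omega
      · rw [hlam.2.1 i (by omega)]; exact Nat.zero_le _
    · rw [ht]
      by_cases hi : i + 1 < k
      · rw [if_pos hi, if_neg (Nat.succ_ne_zero i), Nat.add_sub_cancel]
        exact min_le_right _ _
      · rw [if_neg hi]; exact Nat.zero_le _
  have hrect : IsRectPartition k r tlam := by
    refine ⟨fun i => (hstrip i).2.trans (hstrip i).1, fun i hi => ?_, hle⟩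
    rw [ht, if_neg (by omega)]
  have hbound : ∀ i, i < k → tlam i + mu (k - 1 - i) ≤ r := by
    intro i hi
    have := hmu.2.2 (k - 1 - i)
    rw [ht]; split_ifs <;> omega
  have hconj : ∀ j, j < r → conj tlam j =
      if conj lam j + conj mu (r - 1 - j) < k then conj lam j + 1 else conj lam j := by
    intro j hj
    have hsum : conj lam j + conj mu (r - 1 - j) ≤ k := by
      by_contra hcon
      have hmk : ¬ k < conj mu (r - 1 - j) := by
        rw [lt_conj_iff hmu, hmu.2.1 k le_rfl]; omega
      have hlk : ¬ k < conj lam j := by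
        rw [lt_conj_iff hlam, hlam.2.1 k le_rfl]; omega
      have h1 := (lt_conj_iff hlam (conj lam j - 1) j).1 (by omega)
      have h2 := (lt_conj_iff hmu (k - 1 - (conj lam j - 1)) (r - 1 - j)).1 (by omega)
      have h3 := hno (conj lam j - 1) (by omega)
      omega
    have hmin : conj tlam j = min (k - conj mu (r - 1 - j)) (conj lam j + 1) := by
      apply eq_of_forall_lt_iff
      intro i
      rw [lt_conj_iff hrect, ht]
      have h1 := lt_conj_iff hmu (k - 1 - i) (r - 1 - j)
      have h2 := lt_conj_iff hlam (i - 1) j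
      split_ifs <;> omega
    rw [hmin]
    split_ifs <;> omega
  have htsum : (∑ i ∈ Finset.range k, tlam i) = (∑ i ∈ Finset.range k, lam i) + m := by
    have hm2 : m = ∑ j ∈ Finset.range r,
        if conj lam j + conj mu (r - 1 - j) < k then 1 else 0 := by
      rw [hm, ← Finset.card_filter, ← Set.ncard_coe_finset]
      congr 1
      ext a
      simp
    rw [sum_conj hrect, sum_conj hlam, hm2, ← Finset.sum_add_distrib]
    refine Finset.sum_congr rfl fun j hj => ?_
    rw [hconj j (Finset.mem_range.1 hj)]
    split_ifs <;> rfl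
  refine ⟨tlam, hconj, hrect, hstrip, htsum, hbound, ?_⟩
  intro nu hnu hs hb
  have hpt : ∀ i, nu i ≤ tlam i := by
    intro i
    rw [ht]
    by_cases hi : i < k
    · have h1 := hb i hi
      rcases Nat.eq_zero_or_pos i with h0 | h0
      · rw [if_pos hi, if_pos h0]; omega
      · have h2 := (hs (i - 1)).2
        rw [Nat.sub_add_cancel h0] at h2
        rw [if_pos hi, if_neg (by omega)]; omega
    · rw [hnu.2.1 i (by omega)]; exact Nat.zero_le _
  refine ⟨htsum ▸ Finset.sum_le_sum fun i _ => hpt i, fun heq => ?_⟩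
  rw [← htsum] at heq
  have h := (Finset.sum_eq_sum_iff_of_le fun i _ => hpt i).1 heq
  funext i
  by_cases hi : i < k
  · exact h i (Finset.mem_range.2 hi)
  · rw [hnu.2.1 i (by omega), hrect.2.1 i (by omega)]
end

section
/- Let 0 < k < n be integers and let λ and μ be partitions fitting in the k×(n−k) rectangle. Then there exists a partition ν fitting in the k×(n−k) rectangle with Littlewood–Richardson number c_{λμ}^{ν} ≥ 1 if and only if λ_i + μ_{k+1−i} ≤ n−k for all 1 ≤ i ≤ k (that is, if and only if λ and the 180°-rotation of μ inside the rectangle do not overlap). -/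
theorem rect_anti {k r : ℕ} {p : ℕ → ℕ} (h : IsRectPartition k r p) : Antitone p :=
  antitone_nat_of_succ_le h.1

theorem skew_finite {k r : ℕ} {lam nu : ℕ → ℕ} (hnu : IsRectPartition k r nu)
    (S : Set (ℕ × ℕ)) (hS : ∀ p ∈ S, InSkew lam nu p.1 p.2) : S.Finite := by
  refine ((Set.finite_Iio k).prod (Set.finite_Iio r)).subset ?_
  rintro ⟨a, b⟩ hp
  have h := (hS _ hp).2
  simp only [Set.mem_prod, Set.mem_Iio]
  have h2 := hnu.2.2 a
  refine ⟨?_, by simp only at h; omega⟩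
  by_contra hc
  have := hnu.2.1 a (by omega)
  simp only at h
  omega

theorem lr_step {k r : ℕ} {lam mu nu : ℕ → ℕ} {T : ℕ → ℕ → ℕ}
    (hnu : IsRectPartition k r nu) (hT : IsLRFilling lam mu nu T) (e m : ℕ) (he : 1 ≤ e) :
    Set.ncard {p : ℕ × ℕ | InSkew lam nu p.1 p.2 ∧ p.1 < m + 1 ∧ T p.1 p.2 = e + 1} ≤
    Set.ncard {p : ℕ × ℕ | InSkew lam nu p.1 p.2 ∧ p.1 < m ∧ T p.1 p.2 = e} := by
  obtain ⟨_, _, hrow, _, hY, _⟩ := hT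
  have key : ∃ c, (∀ j, InSkew lam nu m j → T m j = e + 1 → c ≤ j) ∧
      (∀ j, InSkew lam nu m j → c ≤ j → T m j ≠ e) := by
    by_cases hex : ∃ j, InSkew lam nu m j ∧ T m j = e + 1
    · classical
      refine ⟨Nat.find hex, fun j h1 h2 => Nat.find_min' hex ⟨h1, h2⟩, fun j h1 h2 h3 => ?_⟩
      have h := Nat.find_spec hex
      have := hrow m _ _ h.1 h1 h2
      omega
    · refine ⟨nu m, fun j h1 h2 => (hex ⟨j, h1, h2⟩).elim, fun j h1 h2 => ?_⟩
      have := h1.2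
      omega
  obtain ⟨c, hc1, hc2⟩ := key
  have hYm := hY m c e he
  refine le_trans (Set.ncard_le_ncard ?_ (skew_finite hnu _ fun p hp => hp.1))
    (hYm.trans (Set.ncard_le_ncard ?_ (skew_finite hnu _ fun p hp => hp.1)))
  · rintro ⟨a, b⟩ ⟨h1, h2, h3⟩
    refine ⟨h1, ?_, h3⟩
    simp only at h1 h2 h3 ⊢
    by_cases hm : a = m
    · subst hm
      exact Or.inr ⟨rfl, hc1 b h1 h3⟩
    · left; omega
  · rintro ⟨a, b⟩ ⟨h1, h2, h3⟩
    refine ⟨h1, ?_, h3⟩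
    simp only at h1 h2 h3 ⊢
    rcases h2 with h2 | ⟨rfl, h2⟩
    · exact h2
    · exact (hc2 b h1 h2 h3).elim

theorem lr_chain {k r : ℕ} {lam mu nu : ℕ → ℕ} {T : ℕ → ℕ → ℕ}
    (hnu : IsRectPartition k r nu) (hT : IsLRFilling lam mu nu T) (m e : ℕ) :
    Set.ncard {p : ℕ × ℕ | InSkew lam nu p.1 p.2 ∧ p.1 < m + e ∧ T p.1 p.2 = e + 1} ≤
    Set.ncard {p : ℕ × ℕ | InSkew lam nu p.1 p.2 ∧ p.1 < m ∧ T p.1 p.2 = 1} := by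
  induction e with
  | zero => simp
  | succ e ih => exact (lr_step hnu hT (e + 1) (m + e) (by omega)).trans ih

theorem lr_forward {k r : ℕ} {lam mu nu : ℕ → ℕ} {T : ℕ → ℕ → ℕ}
    (hlam : IsRectPartition k r lam)
    (hnu : IsRectPartition k r nu) (hT : IsLRFilling lam mu nu T) (i : ℕ) (hi : i < k) :
    lam i + mu (k - 1 - i) ≤ r := by
  have h := lr_chain hnu hT (i + 1) (k - 1 - i)
  have h1 : mu (k - 1 - i) ≤ Set.ncard {p : ℕ × ℕ | InSkew lam nu p.1 p.2 ∧
      p.1 < i + 1 + (k - 1 - i) ∧ T p.1 p.2 = k - 1 - i + 1} := by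
    rw [← hT.2.2.2.2.2 (k - 1 - i)]
    refine Set.ncard_le_ncard ?_ (skew_finite hnu _ fun p hp => hp.1)
    rintro ⟨a, b⟩ ⟨h1, h2⟩
    refine ⟨h1, ?_, h2⟩
    by_contra hc
    have h3 := hnu.2.1 a (by simp only at hc; omega)
    have := h1.2
    simp only at this
    omega
  have h2 : Set.ncard {p : ℕ × ℕ | InSkew lam nu p.1 p.2 ∧ p.1 < i + 1 ∧ T p.1 p.2 = 1} ≤
      r - lam i := by
    have : (Set.Ico (lam i) r).ncard = r - lam i := by
      rw [← Finset.coe_Ico, Set.ncard_coe_finset, Nat.card_Ico]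
    rw [← this]
    refine Set.ncard_le_ncard_of_injOn Prod.snd ?_ ?_ (Set.finite_Ico _ _)
    · rintro ⟨a, b⟩ ⟨h1, h2, h3⟩
      simp only at h1 h2 h3
      have h4 : lam i ≤ lam a := rect_anti hlam (by omega)
      have h5 := hnu.2.2 a
      have h6 := h1.1
      have h7 := h1.2
      simp only [Set.mem_Ico]
      omega
    · rintro ⟨a, b⟩ ⟨h1, h2, h3⟩ ⟨a', b'⟩ ⟨h1', h2', h3'⟩ hb
      simp only at h1 h2 h3 h1' h2' h3' hb
      subst hb
      rcases lt_trichotomy a a' with hl | hl | hl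
      · have := hT.2.2.2.1 a a' b hl h1 h1'
        omega
      · rw [hl]
      · have := hT.2.2.2.1 a' a b hl h1' h1
        omega
  have := hlam.2.2 i
  omega

theorem lr_finite {k r : ℕ} {lam mu nu : ℕ → ℕ}
    (hmu : IsRectPartition k r mu)
    (hnu : IsRectPartition k r nu) : {T : ℕ → ℕ → ℕ | IsLRFilling lam mu nu T}.Finite := by
  have hbd : ∀ T, IsLRFilling lam mu nu T → ∀ i j, T i j < k + 1 := by
    intro T hT i j
    by_cases hs : InSkew lam nu i j
    · by_contra hc
      have h0 := hT.2.2.2.2.2 (T i j - 1)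
      rw [hmu.2.1 _ (by omega), Set.ncard_eq_zero (skew_finite hnu _ fun p hp => hp.1)] at h0
      have : (i, j) ∈ ({p : ℕ × ℕ | InSkew lam nu p.1 p.2 ∧ T p.1 p.2 = T i j - 1 + 1}) :=
        ⟨hs, by simp only; omega⟩
      rw [h0] at this
      exact this
    · rw [hT.1 i j hs]; omega
  refine Set.Finite.of_finite_image
    (f := fun T => fun (i : Fin k) (j : Fin r) => Fin.ofNat (k + 1) (T i j)) (Set.toFinite _) ?_
  intro T hT T' hT' heq
  funext i j
  by_cases hs : InSkew lam nu i j
  · have h1 := hs.2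
    have h2 := hnu.2.2 i
    have hi : i < k := by
      by_contra hc
      have := hnu.2.1 i (by omega)
      omega
    have h3 := congrFun (congrFun heq ⟨i, hi⟩) ⟨j, by omega⟩
    have h4 := congrArg Fin.val h3
    simp only [Fin.ofNat] at h4
    rwa [Nat.mod_eq_of_lt (hbd T hT i j), Nat.mod_eq_of_lt (hbd T' hT' i j)] at h4
  · rw [hT.1 i j hs, hT'.1 i j hs]

theorem exists_conj {k r : ℕ} {p : ℕ → ℕ} (h : IsRectPartition k r p) :
    ∃ A : ℕ → ℕ, ∀ i j, i < A j ↔ j < p i := by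
  classical
  have hex : ∀ j, ∃ i, p i ≤ j := fun j => ⟨k, by rw [h.2.1 k le_rfl]; omega⟩
  refine ⟨fun j => Nat.find (hex j), fun i j => ?_⟩
  simp only [Nat.lt_find_iff, not_le]
  exact ⟨fun h => h i le_rfl, fun h1 m hm => h1.trans_le (rect_anti h hm)⟩

theorem lr_backward {k r : ℕ} {lam mu : ℕ → ℕ}
    (hlam : IsRectPartition k r lam) (hmu : IsRectPartition k r mu)
    (hcond : ∀ i, i < k → lam i + mu (k - 1 - i) ≤ r) :
    ∃ nu, IsRectPartition k r nu ∧ ∃ T, IsLRFilling lam mu nu T := by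
  classical
  obtain ⟨A, hA⟩ := exists_conj hlam
  obtain ⟨M, hM⟩ := exists_conj hmu
  set B : ℕ → ℕ := fun j => M (r - 1 - j) with hB
  have hBm : ∀ e j, j < r → (e < B j ↔ r - mu e ≤ j) := by
    intro e j hj
    have := hmu.2.2 e
    rw [hB]
    simp only [hM]
    omega
  have hAanti : ∀ j j', j ≤ j' → A j' ≤ A j := by
    intro j j' h
    by_contra hc
    have h1 := (hA (A j) j').1 (by omega)
    have h2 := (hA (A j) j).2 (by omega)
    omega
  have hAB : ∀ j, j < r → A j + B j ≤ k := by
    intro j hj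
    by_contra hc
    by_cases h0 : A j = 0
    · have h1 := (hBm k j hj).1 (by omega)
      rw [hmu.2.1 k le_rfl] at h1
      omega
    · have h1 := (hA (A j - 1) j).1 (by omega)
      have hk : A j - 1 < k := by
        by_contra hk
        have := hlam.2.1 (A j - 1) (by omega)
        omega
      have h2 := hcond _ hk
      have h3 := (hBm (k - 1 - (A j - 1)) j hj).1 (by omega)
      omega
  set P : ℕ → ℕ → Prop := fun m j => j < r ∧ m < A j + B j with hP
  have hPA : ∀ m j, j < lam m → P m j := by
    intro m j h
    have h1 := (hA m j).2 h
    have := hlam.2.2 m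
    exact ⟨by omega, by omega⟩
  have hPfin : ∀ m, (setOf (P m)).Finite := fun m =>
    (Set.finite_Iio r).subset fun j hj => hj.1
  set nu : ℕ → ℕ := fun m => (hPfin m).toFinset.card with hnudef
  have hPanti : ∀ m m' j, m ≤ m' → P m' j → P m j := fun m m' j h h1 =>
    ⟨h1.1, lt_of_le_of_lt h h1.2⟩
  have hnu : IsRectPartition k r nu := by
    refine ⟨fun i => ?_, fun i hi => ?_, fun i => ?_⟩
    · apply Finset.card_le_card
      intro j
      simp only [Set.Finite.mem_toFinset, Set.mem_setOf_eq]
      exact hPanti i (i + 1) j (by omega)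
    · rw [hnudef]
      simp only [Finset.card_eq_zero]
      ext j
      simp only [Set.Finite.mem_toFinset, Set.mem_setOf_eq, Finset.notMem_empty, iff_false]
      rintro ⟨h1, h2⟩
      have := hAB j h1
      omega
    · refine (Finset.card_le_card (t := Finset.range r) ?_).trans (by simp)
      intro j
      simp only [Set.Finite.mem_toFinset, Set.mem_setOf_eq, Finset.mem_range]
      exact fun h => h.1
  have hcount : ∀ m j, j ≤ lam m → Nat.count (P m) j = j := by
    intro m j hj
    rw [Nat.count_iff_forall]
    intro j' hj'
    exact hPA m j' (by omega)
  have hfor : ∀ m c, InSkew lam nu m c →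
      P m (Nat.nth (P m) c) ∧ Nat.count (P m) (Nat.nth (P m) c) = c ∧
        A (Nat.nth (P m) c) ≤ m := by
    intro m c hc
    have h1 : P m (Nat.nth (P m) c) := Nat.nth_mem c fun hf => hc.2
    have h2 : Nat.count (P m) (Nat.nth (P m) c) = c := Nat.count_nth fun hf => hc.2
    refine ⟨h1, h2, ?_⟩
    by_contra hcon
    have h3 := (hA m _).1 (not_le.1 hcon)
    have h4 := hcount m _ h3.le
    have := hc.1
    omega
  have hback : ∀ m j, P m j → A j ≤ m →
      InSkew lam nu m (Nat.count (P m) j) ∧ Nat.nth (P m) (Nat.count (P m) j) = j := by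
    intro m j hj hm
    refine ⟨⟨?_, ?_⟩, Nat.nth_count hj⟩
    · have h1 : lam m ≤ j := by
        by_contra hc
        have := (hA m j).2 (by omega)
        omega
      calc lam m = Nat.count (P m) (lam m) := (hcount m _ le_rfl).symm
        _ ≤ _ := Nat.count_monotone _ h1
    · exact Nat.count_lt_card (hPfin m) hj
  set T : ℕ → ℕ → ℕ := fun m c =>
    if InSkew lam nu m c then m - A (Nat.nth (P m) c) + 1 else 0 with hTdef
  have hTin : ∀ m c, InSkew lam nu m c → T m c = m - A (Nat.nth (P m) c) + 1 := by
    intro m c h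
    rw [hTdef]
    simp only [if_pos h]
  refine ⟨nu, hnu, T, ?_, ?_, ?_, ?_, ?_, ?_⟩
  · intro i j h
    rw [hTdef]
    simp only [if_neg h]
  · intro i j h
    rw [hTin i j h]
    omega
  · intro i j1 j2 h1 h2 h
    rw [hTin _ _ h1, hTin _ _ h2]
    have h3 : Nat.nth (P i) j1 ≤ Nat.nth (P i) j2 := Nat.nth_le_nth' h fun hf => h2.2
    have := hAanti _ _ h3
    omega
  · intro i1 i2 j hi h1 h2
    rw [hTin _ _ h1, hTin _ _ h2]
    obtain ⟨a1, a2, a3⟩ := hfor _ _ h1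
    obtain ⟨b1, b2, b3⟩ := hfor _ _ h2
    have h3 : Nat.nth (P i1) j ≤ Nat.nth (P i2) j := by
      by_contra hc
      have hlt := not_le.1 hc
      have h5 : Nat.count (P i2) (Nat.nth (P i2) j) ≤ Nat.count (P i1) (Nat.nth (P i2) j) :=
        Nat.count_mono_left fun x _ hx => hPanti i1 i2 x hi.le hx
      have h6 : Nat.count (P i1) (Nat.nth (P i2) j) < Nat.count (P i1) (Nat.nth (P i1) j) :=
        Nat.count_strict_mono (hPanti i1 i2 _ hi.le b1) hlt
      omega
    have := hAanti _ _ h3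
    omega
  · intro m c e he
    refine Set.ncard_le_ncard_of_injOn
      (fun p => (p.1 - 1, Nat.count (P (p.1 - 1)) (Nat.nth (P p.1) p.2))) ?_ ?_
      (skew_finite hnu _ fun p hp => hp.1)
    · rintro ⟨a, b⟩ ⟨h1, h2, h3⟩
      simp only at h1 h2 h3
      rw [hTin _ _ h1] at h3
      obtain ⟨a1, a2, a3⟩ := hfor _ _ h1
      obtain ⟨b1, b2⟩ := hback (a - 1) _ (hPanti (a - 1) a _ (by omega) a1) (by omega)
      refine ⟨b1, Or.inl ?_, ?_⟩
      · simp only; omega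
      · simp only
        rw [hTin _ _ b1, b2]
        omega
    · rintro ⟨a, b⟩ ⟨h1, h2, h3⟩ ⟨a', b'⟩ ⟨h1', h2', h3'⟩ heq
      simp only [Prod.mk.injEq] at h1 h2 h3 h1' h2' h3' heq
      rw [hTin _ _ h1] at h3
      rw [hTin _ _ h1'] at h3'
      obtain ⟨a1, a2, a3⟩ := hfor _ _ h1
      obtain ⟨a1', a2', a3'⟩ := hfor _ _ h1'
      have haa : a = a' := by omega
      subst haa
      have h4 := Nat.count_injective (hPanti (a - 1) a _ (by omega) a1)
        (hPanti (a - 1) a _ (by omega) a1') heq.2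
      rw [← a2, ← a2', h4]
  · intro e
    have hcard : (Set.Ico (r - mu e) r).ncard = mu e := by
      rw [← Finset.coe_Ico, Set.ncard_coe_finset, Nat.card_Ico]
      have := hmu.2.2 e
      omega
    rw [← hcard]
    refine Set.BijOn.ncard_eq (f := fun p : ℕ × ℕ => Nat.nth (P p.1) p.2) ⟨?_, ?_, ?_⟩
    · rintro ⟨a, b⟩ ⟨h1, h3⟩
      simp only at h1 h3 ⊢
      rw [hTin _ _ h1] at h3
      obtain ⟨a1, a2, a3⟩ := hfor _ _ h1
      have := a1.2
      exact ⟨(hBm e _ a1.1).1 (by omega), a1.1⟩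
    · rintro ⟨a, b⟩ ⟨h1, h3⟩ ⟨a', b'⟩ ⟨h1', h3'⟩ heq
      simp only at h1 h3 h1' h3' heq
      rw [hTin _ _ h1] at h3
      rw [hTin _ _ h1'] at h3'
      obtain ⟨a1, a2, a3⟩ := hfor _ _ h1
      obtain ⟨a1', a2', a3'⟩ := hfor _ _ h1'
      rw [← heq] at h3' a3'
      have haa : a = a' := by omega
      subst haa
      rw [← a2, ← a2', heq]
    · rintro j ⟨h1, h2⟩
      have h3 := (hBm e j h2).2 h1
      obtain ⟨b1, b2⟩ := hback (A j + e) j ⟨h2, by omega⟩ (by omega)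
      refine ⟨(A j + e, Nat.count (P (A j + e)) j), ⟨b1, ?_⟩, b2⟩
      simp only
      rw [hTin _ _ b1, b2]
      omega

/-- For `λ`, `μ` in the `k × (n−k)` rectangle, there is a partition
`ν` in the rectangle with `c_{λμ}^{ν} ≥ 1` if and only if `λ_i + μ_{k+1−i} ≤ n−k`
for all `1 ≤ i ≤ k`, i.e. iff `λ` and the 180°-rotation of `μ` inside the rectangle
do not overlap. -/
theorem exists_nu_lrCoeff_pos_iff (n k : ℕ) (hk : 0 < k) (hkn : k < n)
    (lam mu : ℕ → ℕ)
    (hlam : IsRectPartition k (n - k) lam) (hmu : IsRectPartition k (n - k) mu) :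
    (∃ nu : ℕ → ℕ, IsRectPartition k (n - k) nu ∧ 1 ≤ lrCoeff lam mu nu) ↔
      (∀ i, i < k → lam i + mu (k - 1 - i) ≤ n - k) := by
  constructor
  · rintro ⟨nu, hnu, hpos⟩
    obtain ⟨T, hT⟩ := Set.nonempty_of_ncard_ne_zero (Nat.one_le_iff_ne_zero.1 hpos)
    exact fun i hi => lr_forward hlam hnu hT i hi
  · intro h
    obtain ⟨nu, hnu, T, hT⟩ := lr_backward hlam hmu h
    exact ⟨nu, hnu, (Set.ncard_pos (lr_finite hmu hnu)).2 ⟨T, hT⟩⟩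
end
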